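/- (Identity for the restricted estimation error) Under Assumption 1, for any λ > 0 the restricted estimation error admits the closed form β*_S − α̂_S = −(X_SᵀW X_S/n)⁻¹·(X_Sᵀ(ε − r)/n) + λ·(X_SᵀW X_S/n)⁻¹·ν̂_S, and consequently ‖β*_S − α̂_S‖_∞ ≤ ‖(X_SᵀW X_S/n)⁻¹‖_{∞,op}·(λ + ‖Xᵀ(ε − r)/n‖_∞). -/

import Mathlib

open scoped BigOperators
open Matrix

noncomputable section

/-- Logistic function `ρ(u,v) = exp(uᵀv)/(1+exp(uᵀv))`. -/
def rho {ι : Type*} [Fintype ι] (u v : ι → ℝ) : ℝ :=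
  Real.exp (u ⬝ᵥ v) / (1 + Real.exp (u ⬝ᵥ v))

/-- `w(u,v) = exp(uᵀv)/(1+exp(uᵀv))²`. -/
def wFun {ι : Type*} [Fintype ι] (u v : ι → ℝ) : ℝ :=
  Real.exp (u ⬝ᵥ v) / (1 + Real.exp (u ⬝ᵥ v)) ^ 2

/-- The ℓ1-norm of a vector. -/
def l1norm {ι : Type*} [Fintype ι] (v : ι → ℝ) : ℝ := ∑ j, |v j|

/-- The ℓ2-norm of a vector. -/
def l2norm {ι : Type*} [Fintype ι] (v : ι → ℝ) : ℝ := Real.sqrt (∑ j, (v j) ^ 2)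

/-- The ℓ∞-norm of a vector. -/
def linfNorm {ι : Type*} [Fintype ι] (v : ι → ℝ) : ℝ := ⨆ j, |v j|

/-- The ℓ∞-to-ℓ∞ operator norm of a matrix: the maximum absolute row sum. -/
def opInf {ι κ : Type*} [Fintype ι] [Fintype κ] (M : Matrix ι κ ℝ) : ℝ :=
  ⨆ i, ∑ j, |M i j|

/-- The spectral norm (ℓ2-to-ℓ2 operator norm) of a matrix. -/
def op2 {ι κ : Type*} [Fintype ι] [Fintype κ] (M : Matrix ι κ ℝ) : ℝ :=
  sSup {c : ℝ | ∃ v : κ → ℝ, l2norm v = 1 ∧ c = l2norm (M *ᵥ v)}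

/-- The smallest eigenvalue of a symmetric matrix, as the infimum of its
Rayleigh quotient over unit vectors. -/
def eigMin {ι : Type*} [Fintype ι] (M : Matrix ι ι ℝ) : ℝ :=
  sInf {c : ℝ | ∃ v : ι → ℝ, l2norm v = 1 ∧ c = v ⬝ᵥ (M *ᵥ v)}

/-- The largest eigenvalue of a symmetric matrix, as the supremum of its
Rayleigh quotient over unit vectors. -/
def eigMax {ι : Type*} [Fintype ι] (M : Matrix ι ι ℝ) : ℝ :=
  sSup {c : ℝ | ∃ v : ι → ℝ, l2norm v = 1 ∧ c = v ⬝ᵥ (M *ᵥ v)}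

/-- The negative log-likelihood of the logistic regression model,
`L(β) = (1/n)·Σᵢ [log(1+exp(xᵢᵀβ)) − yᵢ·xᵢᵀβ]`. -/
def logLoss {n : ℕ} {ι : Type*} [Fintype ι] (X : Matrix (Fin n) ι ℝ)
    (y : Fin n → ℝ) (β : ι → ℝ) : ℝ :=
  (1 / (n : ℝ)) * ∑ i, (Real.log (1 + Real.exp (X i ⬝ᵥ β)) - y i * (X i ⬝ᵥ β))

/-- A function minimised at `0` up to an error `c * |t|` has derivative at most `c` in absolute
value there. -/
theorem abs_deriv_le_of_forall_le_add_mul_abs {f : ℝ → ℝ} {f' c : ℝ} (hf : HasDerivAt f f' 0)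
    (h : ∀ t, f 0 ≤ f t + c * |t|) : |f'| ≤ c := by
  rw [hasDerivAt_iff_tendsto_slope] at hf
  refine abs_le.2 ⟨?_, ?_⟩
  · refine ge_of_tendsto (hf.mono_left (nhdsWithin_mono (0 : ℝ) (s := Set.Ioi 0)
      fun t ht => ne_of_gt ht)) ?_
    filter_upwards [self_mem_nhdsWithin] with t ht
    have ht : 0 < t := ht
    have := h t
    rw [abs_of_pos ht] at this
    rw [slope_def_field, sub_zero, le_div_iff₀ ht]
    linarith
  · refine le_of_tendsto (hf.mono_left (nhdsWithin_mono (0 : ℝ) (s := Set.Iio 0)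
      fun t ht => ne_of_lt ht)) ?_
    filter_upwards [self_mem_nhdsWithin] with t ht
    have ht : t < 0 := ht
    have := h t
    rw [abs_of_neg ht] at this
    rw [slope_def_field, sub_zero, div_le_iff_of_neg ht]
    linarith

theorem isUnit_det_of_eigMin_pos {ι : Type*} [Fintype ι] [DecidableEq ι] {M : Matrix ι ι ℝ}
    (h : 0 < eigMin M) : IsUnit M.det := by
  by_contra hM
  rw [isUnit_iff_ne_zero, not_not] at hM
  obtain ⟨v, hv, hMv⟩ := Matrix.exists_mulVec_eq_zero_iff.2 hM
  have hpos : 0 < ∑ j, v j ^ 2 := by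
    obtain ⟨j, hj⟩ := Function.ne_iff.1 hv
    exact Finset.sum_pos' (fun i _ => sq_nonneg _) ⟨j, Finset.mem_univ _, by
      have : v j ≠ 0 := hj
      positivity⟩
  have hbdd : BddBelow {c : ℝ | ∃ v : ι → ℝ, l2norm v = 1 ∧ c = v ⬝ᵥ (M *ᵥ v)} := by
    by_contra hb
    exact h.ne' (Real.sInf_of_not_bddBelow hb)
  refine absurd (csInf_le hbdd ⟨(l2norm v)⁻¹ • v, ?_, ?_⟩) (not_le.2 h)
  · simp only [l2norm, Pi.smul_apply, smul_eq_mul, mul_pow, ← Finset.mul_sum, inv_pow,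
      Real.sq_sqrt hpos.le]
    rw [inv_mul_cancel₀ hpos.ne', Real.sqrt_one]
  · simp [Matrix.mulVec_smul, hMv]

theorem abs_le_linfNorm {ι : Type*} [Fintype ι] (v : ι → ℝ) (j : ι) : |v j| ≤ linfNorm v :=
  le_ciSup (f := fun j => |v j|) (Set.finite_range _).bddAbove j

theorem linfNorm_mulVec_le {ι κ : Type*} [Fintype ι] [Fintype κ] [Nonempty ι]
    (M : Matrix ι κ ℝ) {u : κ → ℝ} {C : ℝ} (hC : 0 ≤ C) (hu : ∀ j, |u j| ≤ C) :
    linfNorm (M *ᵥ u) ≤ opInf M * C := by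
  refine ciSup_le fun i => ?_
  calc |(M *ᵥ u) i| ≤ ∑ j, |M i j * u j| := Finset.abs_sum_le_sum_abs _ _
    _ ≤ ∑ j, |M i j| * C := Finset.sum_le_sum fun j _ => by
        rw [abs_mul]
        exact mul_le_mul_of_nonneg_left (hu j) (abs_nonneg _)
    _ = (∑ j, |M i j|) * C := (Finset.sum_mul _ _ _).symm
    _ ≤ opInf M * C := mul_le_mul_of_nonneg_right
        (le_ciSup (f := fun i => ∑ j, |M i j|) (Set.finite_range _).bddAbove i) hC

theorem hasDerivAt_logLoss_add_single {n : ℕ} {ι : Type*} [Fintype ι] [DecidableEq ι]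
    (X : Matrix (Fin n) ι ℝ) (y : Fin n → ℝ) (β : ι → ℝ) (j : ι) :
    HasDerivAt (fun t : ℝ => logLoss X y (β + Pi.single j t))
      ((1 / (n : ℝ)) * ∑ i, X i j * (rho (X i) β - y i)) 0 := by
  unfold logLoss
  refine HasDerivAt.const_mul _ (HasDerivAt.fun_sum fun i _ => ?_)
  have hlin : HasDerivAt (fun t : ℝ => X i ⬝ᵥ (β + Pi.single j t)) (X i j) 0 := by
    simpa [dotProduct_add] using ((hasDerivAt_id (0 : ℝ)).const_mul (X i j)).const_add (X i ⬝ᵥ β)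
  have hne : 1 + Real.exp (X i ⬝ᵥ (β + Pi.single j 0)) ≠ 0 := by positivity
  refine (((hlin.exp.const_add 1).log hne).fun_sub (hlin.const_mul (y i))).congr_deriv ?_
  simp only [rho, Pi.single_zero, add_zero]
  ring

theorem l1norm_add_single_le {ι : Type*} [Fintype ι] [DecidableEq ι] (v : ι → ℝ) (j : ι)
    (t : ℝ) : l1norm (v + Pi.single j t) ≤ l1norm v + |t| := by
  calc l1norm (v + Pi.single j t) ≤ ∑ k, (|v k| + |(Pi.single j t : ι → ℝ) k|) :=
        Finset.sum_le_sum fun k _ => abs_add_le _ _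
    _ = l1norm v + |t| := by
        have hsingle : ∑ k, |(Pi.single j t : ι → ℝ) k| = |t| := by
          rw [Finset.sum_eq_single_of_mem j (Finset.mem_univ j) fun k _ hk => by simp [hk]]
          simp
        rw [Finset.sum_add_distrib, hsingle, l1norm]

/-- The stationarity bound for the `ℓ1`-penalised logistic loss. -/
theorem abs_score_le_of_isMin {n : ℕ} {ι : Type*} [Fintype ι]
    {X : Matrix (Fin n) ι ℝ} {y : Fin n → ℝ} {lam : ℝ} (hlam : 0 ≤ lam) {α : ι → ℝ}
    (hα : ∀ θ, logLoss X y α + lam * l1norm α ≤ logLoss X y θ + lam * l1norm θ) (j : ι) :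
    |(1 / (n : ℝ)) * ∑ i, X i j * (y i - rho (X i) α)| ≤ lam := by
  classical
  have h := abs_deriv_le_of_forall_le_add_mul_abs (c := lam)
    (hasDerivAt_logLoss_add_single X y α j) fun t => by
      have hmin := hα (α + Pi.single j t)
      have hnorm := mul_le_mul_of_nonneg_left (l1norm_add_single_le α j t) hlam
      simp only [Pi.single_zero, add_zero]
      linarith
  rw [← abs_neg, ← mul_neg, ← Finset.sum_neg_distrib]
  simpa only [← mul_neg, neg_sub] using h

theorem dotProduct_eq_of_support_subset {p : ℕ} {S : Finset (Fin p)} {u b : Fin p → ℝ}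
    (hb : ∀ j, j ∉ S → b j = 0) :
    u ⬝ᵥ b = (fun j : {j // j ∈ S} => u j.1) ⬝ᵥ fun j => b j.1 := by
  simp only [dotProduct]
  rw [Finset.sum_coe_sort S fun j => u j * b j]
  exact (Finset.sum_subset (Finset.subset_univ S) fun j _ hj => by simp [hb j hj]).symm

theorem restricted_error_identity
    (n p : ℕ) (X : Matrix (Fin n) (Fin p) ℝ) (y : Fin n → ℝ)
    (hy : ∀ i, y i = 0 ∨ y i = 1)
    (c_b : ℝ) (hcb : 0 < c_b) (hXb : ∀ i j, |X i j| ≤ c_b)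
    (βs : Fin p → ℝ) (S : Finset (Fin p)) (hS : ∀ j, j ∈ S ↔ βs j ≠ 0)
    (s : ℕ) (hs : s = S.card)
    (W : Matrix (Fin n) (Fin n) ℝ)
    (hW : W = Matrix.diagonal fun i => wFun (X i) βs)
    (XS : Matrix (Fin n) {j // j ∈ S} ℝ) (hXS : ∀ i j, XS i j = X i j.1)
    (cmin : ℝ) (hcmin : cmin = eigMin ((1 / (n : ℝ)) • (XSᵀ * W * XS)))
    (hA1 : 0 < cmin)
    (ε : Fin n → ℝ) (hε : ∀ i, ε i = y i - rho (X i) βs)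
    (lam : ℝ) (hlam : 0 < lam)
    (αS : {j // j ∈ S} → ℝ)
    (hαS : ∀ θ : {j // j ∈ S} → ℝ,
      logLoss XS y αS + lam * l1norm αS ≤ logLoss XS y θ + lam * l1norm θ)
    (αhat : Fin p → ℝ)
    (hαhat : ∀ j : Fin p, αhat j = if h : j ∈ S then αS ⟨j, h⟩ else 0)
    (ν : Fin p → ℝ)
    (hν : ∀ j, ν j = (1 / ((n : ℝ) * lam)) * ∑ i, X i j * (y i - rho (X i) αhat))
    (r : Fin n → ℝ)
    (hr : ∀ i, r i = rho (XS i) αS - rho (XS i) (fun j => βs j.1)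
      - wFun (XS i) (fun j => βs j.1) * (XS i ⬝ᵥ (fun j => αS j - βs j.1))) :
    ((fun j : {j // j ∈ S} => βs j.1 - αS j)
        = -(((1 / (n : ℝ)) • (XSᵀ * W * XS))⁻¹
              *ᵥ ((1 / (n : ℝ)) • (XSᵀ *ᵥ (ε - r))))
          + lam • (((1 / (n : ℝ)) • (XSᵀ * W * XS))⁻¹
              *ᵥ (fun j : {j // j ∈ S} => ν j.1))) ∧
      linfNorm (fun j : {j // j ∈ S} => βs j.1 - αS j)
        ≤ opInf (((1 / (n : ℝ)) • (XSᵀ * W * XS))⁻¹)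
            * (lam + linfNorm ((1 / (n : ℝ)) • (Xᵀ *ᵥ (ε - r)))) := by
  have hXSrow : ∀ i, XS i = fun j : {j // j ∈ S} => X i j.1 := fun i => funext (hXS i)
  have hβdot : ∀ i, X i ⬝ᵥ βs = XS i ⬝ᵥ fun j => βs j.1 := fun i => by
    rw [hXSrow]
    exact dotProduct_eq_of_support_subset fun j hj => not_not.1 fun h => hj ((hS j).2 h)
  have hαdot : ∀ i, X i ⬝ᵥ αhat = XS i ⬝ᵥ αS := fun i => by
    rw [hXSrow, dotProduct_eq_of_support_subset (S := S) fun j hj => by simp [hαhat, hj]]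
    congr 1
    ext j
    simp [hαhat]
  have hνS : ∀ j : {j // j ∈ S},
      lam * ν j.1 = (1 / (n : ℝ)) * ∑ i, XS i j * (y i - rho (XS i) αS) := fun j => by
    have hrho : ∀ i, rho (X i) αhat = rho (XS i) αS := fun i => by simp only [rho, hαdot]
    simp only [hν, hrho, hXS]
    rw [← mul_assoc]
    congr 1
    field_simp
  rw [hcmin] at hA1
  have hres : ∀ i, (ε - r) i = y i - rho (XS i) αS
      - wFun (X i) βs * (XS i ⬝ᵥ fun j => βs j.1 - αS j) := fun i => by
    have hneg : (XS i ⬝ᵥ fun j => αS j - βs j.1) = -(XS i ⬝ᵥ fun j => βs j.1 - αS j) := by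
      rw [← dotProduct_neg]
      congr 1
      ext j
      simp
    rw [Pi.sub_apply, hε, hr, hneg]
    simp only [rho, wFun, hβdot]
    ring
  set A := (1 / (n : ℝ)) • (XSᵀ * W * XS) with hA
  set u : {j // j ∈ S} → ℝ :=
    -((1 / (n : ℝ)) • (XSᵀ *ᵥ (ε - r))) + lam • (fun j : {j // j ∈ S} => ν j.1) with hu
  have hAu : A *ᵥ (fun j : {j // j ∈ S} => βs j.1 - αS j) = u := by
    ext j
    rw [hA, hu, hW, smul_mulVec, ← mulVec_mulVec, ← mulVec_mulVec]
    simp only [Pi.add_apply, Pi.neg_apply, Pi.smul_apply, smul_eq_mul, hνS]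
    rw [neg_add_eq_sub, ← mul_sub]
    congr 1
    simp only [mulVec, dotProduct, transpose_apply] at hres ⊢
    rw [← Finset.sum_sub_distrib]
    refine Finset.sum_congr rfl fun i _ => ?_
    rw [hres, Finset.sum_eq_single_of_mem i (Finset.mem_univ i) fun k _ hk => by
      simp [diagonal_apply_ne' _ hk], diagonal_apply_eq]
    ring
  have hsol : (fun j : {j // j ∈ S} => βs j.1 - αS j) = A⁻¹ *ᵥ u := by
    rw [← hAu, mulVec_mulVec, nonsing_inv_mul _ (isUnit_det_of_eigMin_pos hA1), one_mulVec]
  refine ⟨by rw [hsol, hu, mulVec_add, mulVec_neg, mulVec_smul A⁻¹ lam], ?_⟩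
  have hne : Nonempty {j // j ∈ S} := by
    by_contra hemp
    rw [not_nonempty_iff] at hemp
    simp [eigMin, l2norm] at hA1
  have hbound : ∀ j, |u j| ≤ lam + linfNorm ((1 / (n : ℝ)) • (Xᵀ *ᵥ (ε - r))) := fun j => by
    have hscore := abs_score_le_of_isMin hlam.le hαS j
    rw [← hνS] at hscore
    have hnoise := abs_le_linfNorm ((1 / (n : ℝ)) • (Xᵀ *ᵥ (ε - r))) j.1
    have hrow : ((1 / (n : ℝ)) • (XSᵀ *ᵥ (ε - r))) j
        = ((1 / (n : ℝ)) • (Xᵀ *ᵥ (ε - r))) j.1 := by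
      simp only [Pi.smul_apply, mulVec, dotProduct, transpose_apply, hXS]
    calc |u j| ≤ |(-((1 / (n : ℝ)) • (XSᵀ *ᵥ (ε - r)))) j| + |lam * ν j.1| := abs_add_le _ _
      _ ≤ _ := by
        rw [Pi.neg_apply, abs_neg, hrow]
        linarith
  rw [hsol]
  exact linfNorm_mulVec_le _ ((abs_nonneg _).trans (hbound hne.some)) hbound
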